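/- arXiv:2309.17266 — 5 statements merged into one kernel-verified Lean document; each statement's English description precedes it below -/
import Mathlib

section
/- Let A ∈ ℝ^{m×n}, B ∈ ℝ^{p×n}, and let X̃ ∈ ℝ^{n×k} have orthonormal columns. Suppose A X̃ = Ũ R_A and B X̃ = Ṽ R_B where Ũ ∈ ℝ^{m×k} and Ṽ ∈ ℝ^{p×k} have orthonormal columns and R_A, R_B ∈ ℝ^{k×k}. Then Ũ^T A X̃ = R_A and Ṽ^T B X̃ = R_B; moreover, for any d̃, ẽ, f̃ ∈ ℝ^k and α̃, β̃ ∈ ℝ, setting x̃ = X̃ d̃, ũ = Ũ ẽ, ṽ = Ṽ f̃, the three conditions (A x̃ = α̃ ũ, B x̃ = β̃ ṽ, and X̃^T (β̃ A^T ũ − α̃ B^T ṽ) = 0) hold if and only if R_A d̃ = α̃ ẽ, R_B d̃ = β̃ f̃, and β̃ R_A^T ẽ = α̃ R_B^T f̃. That is, the standard extraction with respect to these searching subspaces reduces exactly to the vector form of the GSVD of the k×k projected pair (R_A, R_B). -/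
open Matrix

section ThinQR

variable {l m n k : Type*} [Fintype m] [Fintype n] [Fintype k] [DecidableEq k]

theorem mulVec_injective_of_transpose_mul_self_eq_one {U : Matrix m k ℝ} (hU : Uᵀ * U = 1) :
    Function.Injective U.mulVec := fun x y h => by
  simpa [mulVec_mulVec, hU] using congrArg (Uᵀ *ᵥ ·) h

theorem transpose_mul_mul_eq_of_thinQR {A : Matrix m n ℝ} {X : Matrix n l ℝ}
    {U : Matrix m k ℝ} {R : Matrix k l ℝ} (hA : A * X = U * R) (hU : Uᵀ * U = 1) :
    Uᵀ * A * X = R := by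
  rw [Matrix.mul_assoc, hA, ← Matrix.mul_assoc, hU, Matrix.one_mul]

theorem mulVec_mulVec_eq_smul_iff_of_thinQR [Fintype l] {A : Matrix m n ℝ} {X : Matrix n l ℝ}
    {U : Matrix m k ℝ} {R : Matrix k l ℝ} (hA : A * X = U * R) (hU : Uᵀ * U = 1)
    (d : l → ℝ) (e : k → ℝ) (c : ℝ) :
    A *ᵥ (X *ᵥ d) = c • (U *ᵥ e) ↔ R *ᵥ d = c • e := by
  rw [mulVec_mulVec, hA, ← mulVec_mulVec, ← mulVec_smul]
  exact (mulVec_injective_of_transpose_mul_self_eq_one hU).eq_iff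

theorem transpose_mulVec_transpose_mulVec_of_thinQR {A : Matrix m n ℝ} {X : Matrix n l ℝ}
    {U : Matrix m k ℝ} {R : Matrix k l ℝ} (hA : A * X = U * R) (hU : Uᵀ * U = 1)
    (e : k → ℝ) :
    Xᵀ *ᵥ (Aᵀ *ᵥ (U *ᵥ e)) = Rᵀ *ᵥ e := by
  rw [mulVec_mulVec, ← transpose_mul, hA, transpose_mul, mulVec_mulVec, Matrix.mul_assoc, hU,
    Matrix.mul_one]

end ThinQR

/-- With thin QR factorizations `A X̃ = Ũ R_A`, `B X̃ = Ṽ R_B`, one has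
`Ũᵀ A X̃ = R_A`, `Ṽᵀ B X̃ = R_B`, and the standard extraction conditions are
equivalent to the vector form of the GSVD of the projected pair `(R_A, R_B)`. -/
theorem standard_extraction_reduces_to_projected_gsvd (m p n k : ℕ)
    (A : Matrix (Fin m) (Fin n) ℝ) (B : Matrix (Fin p) (Fin n) ℝ)
    (Xt : Matrix (Fin n) (Fin k) ℝ)
    (Ut : Matrix (Fin m) (Fin k) ℝ) (Vt : Matrix (Fin p) (Fin k) ℝ)
    (RA RB : Matrix (Fin k) (Fin k) ℝ)
    (hXt : Xtᵀ * Xt = 1)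
    (hQA : A * Xt = Ut * RA) (hUt : Utᵀ * Ut = 1)
    (hQB : B * Xt = Vt * RB) (hVt : Vtᵀ * Vt = 1) :
    Utᵀ * A * Xt = RA ∧
    Vtᵀ * B * Xt = RB ∧
    ∀ (d e f : Fin k → ℝ) (α β : ℝ),
      (A *ᵥ (Xt *ᵥ d) = α • (Ut *ᵥ e) ∧
       B *ᵥ (Xt *ᵥ d) = β • (Vt *ᵥ f) ∧
       Xtᵀ *ᵥ (β • (Aᵀ *ᵥ (Ut *ᵥ e)) - α • (Bᵀ *ᵥ (Vt *ᵥ f))) = 0)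
      ↔
      (RA *ᵥ d = α • e ∧ RB *ᵥ d = β • f ∧
       β • (RAᵀ *ᵥ e) = α • (RBᵀ *ᵥ f)) := by
  refine ⟨transpose_mul_mul_eq_of_thinQR hQA hUt, transpose_mul_mul_eq_of_thinQR hQB hVt,
    fun d e f α β => ?_⟩
  rw [mulVec_mulVec_eq_smul_iff_of_thinQR hQA hUt, mulVec_mulVec_eq_smul_iff_of_thinQR hQB hVt,
    mulVec_sub, mulVec_smul, mulVec_smul, transpose_mulVec_transpose_mulVec_of_thinQR hQA hUt,
    transpose_mulVec_transpose_mulVec_of_thinQR hQB hVt, sub_eq_zero]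
end

section
/- Let A ∈ ℝ^{m×n}, B ∈ ℝ^{p×n} with B of full column rank, and let L ∈ ℝ^{n×n} be invertible with B^T B = L L^T. Define Ǎ = A L^{-T}. Suppose (α, β, u, v, x) is a GSVD component of (A,B), i.e., α, β > 0, ‖u‖ = ‖v‖ = 1, A x = α u, B x = β v, and β A^T u = α B^T v. Set σ = α/β and z = (1/β) L^T x. Then ‖z‖ = 1, Ǎ z = σ u, and Ǎ^T u = σ z; that is, (σ, u, z) is a singular triplet of the matrix Ǎ = A L^{-T}. -/
open Matrix

/-- Euclidean 2-norm of a vector. -/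
noncomputable def eucNorm {n : ℕ} (x : Fin n → ℝ) : ℝ :=
  Real.sqrt (x ⬝ᵥ x)

/-- For `B` of full column rank with `Bᵀ B = L Lᵀ` (`L` invertible), a GSVD component
`(α, β, u, v, x)` of `(A, B)` gives a singular triplet `(σ, u, z)` of `Ǎ = A L⁻ᵀ`,
where `σ = α/β` and `z = (1/β) Lᵀ x`. -/
theorem gsvd_component_gives_singular_triplet (m p n : ℕ)
    (A : Matrix (Fin m) (Fin n) ℝ) (B : Matrix (Fin p) (Fin n) ℝ)
    (L : Matrix (Fin n) (Fin n) ℝ)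
    (hrank : B.rank = n) (hL : IsUnit L.det) (hBL : Bᵀ * B = L * Lᵀ)
    (α β : ℝ) (u : Fin m → ℝ) (v : Fin p → ℝ) (x : Fin n → ℝ)
    (hα : 0 < α) (hβ : 0 < β)
    (hu : eucNorm u = 1) (hv : eucNorm v = 1)
    (hAx : A *ᵥ x = α • u) (hBx : B *ᵥ x = β • v)
    (hres : β • (Aᵀ *ᵥ u) = α • (Bᵀ *ᵥ v)) :
    let σ : ℝ := α / β
    let z : Fin n → ℝ := (1 / β) • (Lᵀ *ᵥ x)
    let Ac : Matrix (Fin m) (Fin n) ℝ := A * (L⁻¹)ᵀ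
    eucNorm z = 1 ∧ Ac *ᵥ z = σ • u ∧ Acᵀ *ᵥ u = σ • z := by
  intro σ z Ac
  have hβ0 : β ≠ 0 := hβ.ne'
  have hvv : v ⬝ᵥ v = 1 := by
    simpa [eucNorm] using hv
  have hinv : L⁻¹ * L = 1 := Matrix.nonsing_inv_mul L hL
  have hgram : (Lᵀ *ᵥ x) ⬝ᵥ (Lᵀ *ᵥ x) = (B *ᵥ x) ⬝ᵥ (B *ᵥ x) := by
    rw [Matrix.dotProduct_mulVec, Matrix.dotProduct_mulVec, Matrix.vecMul_transpose,
      ← Matrix.mulVec_transpose, Matrix.mulVec_mulVec, Matrix.mulVec_mulVec, hBL]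
  have hBv : L *ᵥ (Lᵀ *ᵥ x) = β • (Bᵀ *ᵥ v) := by
    rw [Matrix.mulVec_mulVec, ← hBL, ← Matrix.mulVec_mulVec, hBx, Matrix.mulVec_smul]
  refine ⟨?_, ?_, ?_⟩
  · have hz : z ⬝ᵥ z = 1 := by
      simp only [z, smul_dotProduct, dotProduct_smul, hgram, hBx, hvv, smul_eq_mul]
      field_simp
    rw [eucNorm, hz, Real.sqrt_one]
  · simp only [z, Ac, σ]
    rw [Matrix.mulVec_smul, Matrix.mulVec_mulVec, Matrix.mul_assoc, ← Matrix.transpose_mul,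
      Matrix.mul_nonsing_inv L hL, Matrix.transpose_one, Matrix.mul_one, hAx, smul_smul]
    congr 1
    ring
  · have hAu : Aᵀ *ᵥ u = σ • (L *ᵥ z) := by
      simp only [z, σ]
      rw [Matrix.mulVec_smul, hBv, smul_smul (1 / β), one_div_mul_cancel hβ0, one_smul,
        div_eq_inv_mul, mul_smul, ← hres, inv_smul_smul₀ hβ0]
    simp only [Ac]
    rw [Matrix.transpose_mul, Matrix.transpose_transpose, ← Matrix.mulVec_mulVec, hAu,
      Matrix.mulVec_smul, Matrix.mulVec_mulVec, hinv, Matrix.one_mulVec]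
end

section
/- Let A ∈ ℝ^{m×n}, B ∈ ℝ^{p×n} with B of full column rank, let L ∈ ℝ^{n×n} be invertible with B^T B = L L^T, and set Ǎ = A L^{-T}. Let X̃ ∈ ℝ^{n×k} have orthonormal columns with thin QR factorizations A X̃ = Ũ R_A and B X̃ = Ṽ R_B (Ũ, Ṽ having orthonormal columns), and set Z̃ = L^T X̃. Let K = [[0, Ǎ^T],[Ǎ, 0]] ∈ ℝ^{(n+m)×(n+m)}, W = [[Z̃, 0],[0, Ũ]] ∈ ℝ^{(n+m)×2k}, and τ, φ ∈ ℝ. Then for any ď, ě ∈ ℝ^k, the condition W^T (K − τ I)(K − φ I) W [ď; ě] = 0 holds if and only if H_c [ď; ě] = (φ − τ) G_c [ď; ě], where H_c = [[R_A^T R_A + τ² R_B^T R_B, −2τ R_A^T],[−2τ R_A, Ũ^T A (B^T B)^{-1} A^T Ũ + τ² I_k]] and G_c = [[−τ R_B^T R_B, R_A^T],[R_A, −τ I_k]]. -/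
open Matrix

/-- A product of two shifts of the augmented matrix `[[0, Cᵀ], [C, 0]]`, projected onto the
column space of `diag(Z, U)`. -/
lemma projected_shift_mul_shift {l m n k : Type*} [Fintype m] [Fintype n]
    [DecidableEq m] [DecidableEq n]
    (C : Matrix m n ℝ) (Z : Matrix n k ℝ) (U : Matrix m l ℝ) (τ φ : ℝ) :
    (fromBlocks Z 0 0 U)ᵀ * (fromBlocks 0 Cᵀ C 0 - τ • 1) * (fromBlocks 0 Cᵀ C 0 - φ • 1) *
        fromBlocks Z 0 0 U =
      fromBlocks ((C * Z)ᵀ * (C * Z) + (τ * φ) • (Zᵀ * Z)) ((-(τ + φ)) • ((C * Z)ᵀ * U))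
        ((-(τ + φ)) • (Uᵀ * (C * Z))) (Uᵀ * (C * Cᵀ) * U + (τ * φ) • (Uᵀ * U)) := by
  rw [← fromBlocks_one (l := n) (m := m), fromBlocks_smul, fromBlocks_smul, sub_eq_add_neg,
    sub_eq_add_neg, fromBlocks_neg, fromBlocks_neg, fromBlocks_add, fromBlocks_add,
    fromBlocks_transpose, fromBlocks_multiply, fromBlocks_multiply, fromBlocks_multiply]
  congr 1 <;>
    simp only [smul_zero, neg_zero, zero_add, add_zero, transpose_zero, Matrix.zero_mul,
      Matrix.mul_zero, transpose_mul, Matrix.mul_assoc, Matrix.add_mul,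
      Matrix.mul_neg, Matrix.neg_mul, Matrix.smul_mul, Matrix.mul_smul,
      Matrix.mul_one] <;>
    module

/-- The CPF-harmonic extraction condition `Wᵀ (K − τI)(K − φI) W [ď; ě] = 0` for the
augmented matrix `K = [[0, Ǎᵀ],[Ǎ, 0]]`, `Ǎ = A L⁻ᵀ`, and `W = diag(Z̃, Ũ)` with
`Z̃ = Lᵀ X̃`, is equivalent to the projected generalized eigenproblem
`H_c [ď; ě] = (φ − τ) G_c [ď; ě]`. -/
theorem cpf_harmonic_extraction_equiv (m p n k : ℕ)
    (A : Matrix (Fin m) (Fin n) ℝ) (B : Matrix (Fin p) (Fin n) ℝ)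
    (L : Matrix (Fin n) (Fin n) ℝ)
    (hL : IsUnit L.det) (hBL : Bᵀ * B = L * Lᵀ)
    (Xt : Matrix (Fin n) (Fin k) ℝ)
    (Ut : Matrix (Fin m) (Fin k) ℝ) (Vt : Matrix (Fin p) (Fin k) ℝ)
    (RA RB : Matrix (Fin k) (Fin k) ℝ)
    (hXt : Xtᵀ * Xt = 1)
    (hQA : A * Xt = Ut * RA) (hUt : Utᵀ * Ut = 1)
    (hQB : B * Xt = Vt * RB) (hVt : Vtᵀ * Vt = 1)
    (τ φ : ℝ) (d e : Fin k → ℝ) :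
    let Ac : Matrix (Fin m) (Fin n) ℝ := A * (L⁻¹)ᵀ
    let Zt : Matrix (Fin n) (Fin k) ℝ := Lᵀ * Xt
    let K : Matrix (Fin n ⊕ Fin m) (Fin n ⊕ Fin m) ℝ := fromBlocks 0 Acᵀ Ac 0
    let W : Matrix (Fin n ⊕ Fin m) (Fin k ⊕ Fin k) ℝ := fromBlocks Zt 0 0 Ut
    let Hc : Matrix (Fin k ⊕ Fin k) (Fin k ⊕ Fin k) ℝ :=
      fromBlocks (RAᵀ * RA + τ ^ 2 • (RBᵀ * RB)) ((-(2 * τ)) • RAᵀ)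
        ((-(2 * τ)) • RA)
        (Utᵀ * A * (Bᵀ * B)⁻¹ * Aᵀ * Ut + τ ^ 2 • (1 : Matrix (Fin k) (Fin k) ℝ))
    let Gc : Matrix (Fin k ⊕ Fin k) (Fin k ⊕ Fin k) ℝ :=
      fromBlocks ((-τ) • (RBᵀ * RB)) RAᵀ RA ((-τ) • (1 : Matrix (Fin k) (Fin k) ℝ))
    ((Wᵀ * (K - τ • 1) * (K - φ • 1) * W) *ᵥ Sum.elim d e = 0
      ↔ Hc *ᵥ Sum.elim d e = (φ - τ) • (Gc *ᵥ Sum.elim d e)) := by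
  intro Ac Zt K W Hc Gc
  have hL' : IsUnit (Lᵀ).det := by rwa [det_transpose]
  have hAZ : Ac * Zt = Ut * RA := by
    rw [← hQA]
    simp only [Ac, Zt, Matrix.mul_assoc, transpose_nonsing_inv]
    rw [nonsing_inv_mul_cancel_left _ _ hL']
  have hZZ : Ztᵀ * Zt = RBᵀ * RB := by
    calc Ztᵀ * Zt = Xtᵀ * (L * Lᵀ) * Xt := by
          simp only [Zt, transpose_mul, transpose_transpose, Matrix.mul_assoc]
      _ = (B * Xt)ᵀ * (B * Xt) := by
          rw [← hBL]; simp only [transpose_mul, Matrix.mul_assoc]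
      _ = RBᵀ * (Vtᵀ * Vt) * RB := by
          rw [hQB]; simp only [transpose_mul, Matrix.mul_assoc]
      _ = RBᵀ * RB := by rw [hVt, Matrix.mul_one]
  have hAA : Ac * Acᵀ = A * (Bᵀ * B)⁻¹ * Aᵀ := by
    rw [hBL, Matrix.mul_inv_rev]
    simp only [Ac, transpose_mul, transpose_transpose, transpose_nonsing_inv, Matrix.mul_assoc]
  have hM : Wᵀ * (K - τ • 1) * (K - φ • 1) * W = Hc - (φ - τ) • Gc := by
    have hUR : Utᵀ * (Ut * RA) = RA := by rw [← Matrix.mul_assoc, hUt, Matrix.one_mul]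
    have hRU : (Ut * RA)ᵀ * Ut = RAᵀ := by
      rw [transpose_mul, Matrix.mul_assoc, hUt, Matrix.mul_one]
    have hRR : (Ut * RA)ᵀ * (Ut * RA) = RAᵀ * RA := by rw [← Matrix.mul_assoc, hRU]
    rw [projected_shift_mul_shift, hAZ, hZZ, hAA, hUR, hRU, hRR, hUt, sub_eq_add_neg,
      fromBlocks_smul, fromBlocks_neg, fromBlocks_add]
    congr 1 <;> simp only [Matrix.mul_assoc, neg_smul] <;> module
  rw [hM, sub_mulVec, smul_mulVec, sub_eq_zero]
end

section
/- Let A ∈ ℝ^{m×n}, B ∈ ℝ^{p×n}. For i = 1, …, q let (α_i, β_i, u_i, v_i, x_i) satisfy A x_i = α_i u_i, B x_i = β_i v_i, β_i A^T u_i = α_i B^T v_i, and suppose the x_i are (A^T A + B^T B)-orthonormal, i.e., x_i^T (A^T A + B^T B) x_j = δ_{ij} for all i, j. Fix j < q, let X_c = [x_1, …, x_j] and Y_c = (A^T A + B^T B) X_c, and define the deflated pair A_d = A (I − X_c Y_c^T), B_d = B (I − X_c Y_c^T). Then for every i with j < i ≤ q: (i) Y_c^T x_i = 0, so (I − X_c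 Y_c^T) x_i = x_i; (ii) A_d x_i = α_i u_i and B_d x_i = β_i v_i; and (iii) β_i A_d^T u_i = α_i B_d^T v_i. Hence (α_i, β_i, u_i, v_i, x_i), i = j+1, …, q, are exact GSVD components of the deflated matrix pair (A_d, B_d) restricted to the range of the oblique projector I − X_c Y_c^T. -/
open Matrix

/-- Deflation: if `(αᵢ, βᵢ, uᵢ, vᵢ, xᵢ)` are GSVD components with `(Aᵀ A + Bᵀ B)`-
orthonormal right vectors, then for `X_c = [x₁, …, x_J]`, `Y_c = (Aᵀ A + Bᵀ B) X_c`,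
the remaining components are exact GSVD components of the deflated pair
`(A (I − X_c Y_cᵀ), B (I − X_c Y_cᵀ))` and are fixed by the oblique projector. -/
theorem deflated_pair_gsvd_components (m p n q J : ℕ)
    (A : Matrix (Fin m) (Fin n) ℝ) (B : Matrix (Fin p) (Fin n) ℝ)
    (α β : Fin q → ℝ)
    (u : Fin q → Fin m → ℝ) (v : Fin q → Fin p → ℝ) (x : Fin q → Fin n → ℝ)
    (hAx : ∀ i, A *ᵥ x i = α i • u i)
    (hBx : ∀ i, B *ᵥ x i = β i • v i)
    (hres : ∀ i, β i • (Aᵀ *ᵥ u i) = α i • (Bᵀ *ᵥ v i))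
    (horth : ∀ i j, (x i) ⬝ᵥ ((Aᵀ * A + Bᵀ * B) *ᵥ x j) = if i = j then 1 else 0)
    (hJ : J < q) :
    let Xc : Matrix (Fin n) (Fin J) ℝ :=
      Matrix.of fun r l => x (Fin.castLE hJ.le l) r
    let Yc : Matrix (Fin n) (Fin J) ℝ := (Aᵀ * A + Bᵀ * B) * Xc
    let Ad : Matrix (Fin m) (Fin n) ℝ := A * (1 - Xc * Ycᵀ)
    let Bd : Matrix (Fin p) (Fin n) ℝ := B * (1 - Xc * Ycᵀ)
    ∀ i : Fin q, J ≤ (i : ℕ) →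
      Ycᵀ *ᵥ x i = 0 ∧
      (1 - Xc * Ycᵀ) *ᵥ x i = x i ∧
      Ad *ᵥ x i = α i • u i ∧
      Bd *ᵥ x i = β i • v i ∧
      β i • (Adᵀ *ᵥ u i) = α i • (Bdᵀ *ᵥ v i) := by
  intro Xc Yc Ad Bd i hi
  have hY : Ycᵀ *ᵥ x i = 0 := by
    ext l
    have hne : i ≠ Fin.castLE hJ.le l := by
      intro h
      have hl := congrArg Fin.val h
      simp only [Fin.val_castLE] at hl
      have := l.isLt
      omega
    have h := horth i (Fin.castLE hJ.le l)
    rw [if_neg hne, dotProduct_comm] at h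
    exact h
  have hP : (1 - Xc * Ycᵀ) *ᵥ x i = x i := by
    rw [sub_mulVec, one_mulVec, ← mulVec_mulVec, hY, mulVec_zero, sub_zero]
  refine ⟨hY, hP, ?_, ?_, ?_⟩
  · rw [← mulVec_mulVec, hP, hAx]
  · rw [← mulVec_mulVec, hP, hBx]
  · rw [transpose_mul A, transpose_mul B, ← mulVec_mulVec, ← mulVec_mulVec,
      ← mulVec_smul _ (β i) (Aᵀ *ᵥ u i), ← mulVec_smul _ (α i) (Bᵀ *ᵥ v i), hres]
end

section
/- Let A ∈ ℝ^{m×n} and B ∈ ℝ^{p×n} with B of full column rank, so that M = B^T B is symmetric positive definite. Let x ∈ ℝ^n with B x ≠ 0, and set γ* = ‖A x‖² / ‖B x‖². Then for every γ ∈ ℝ, ‖(A^T A − γ* B^T B) x‖_{M^{-1}} ≤ ‖(A^T A − γ B^T B) x‖_{M^{-1}}, where ‖w‖_{M^{-1}} = sqrt(w^T M^{-1} w). In particular, if (α, β, u, v, x) satisfies A x = α u, B x = β v with ‖u‖ = ‖v‖ = 1 and α, β > 0, then θ = α/β satisfies ‖(A^T A − θ² B^T B) x‖_{(B^T B)^{-1}}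 ≤ ‖(A^T A − φ² B^T B) x‖_{(B^T B)^{-1}} for every φ ∈ ℝ. -/
open Matrix

/-- The squared `M⁻¹`-norm of `(S - γ M) x` is a quadratic polynomial in `γ`. -/
theorem dotProduct_inv_mulVec_sub_smul {n : Type*} [Fintype n] [DecidableEq n]
    {S M : Matrix n n ℝ} (hM : M.IsSymm) (hdet : IsUnit M.det) (x : n → ℝ) (γ : ℝ) :
    ((S - γ • M) *ᵥ x) ⬝ᵥ (M⁻¹ *ᵥ ((S - γ • M) *ᵥ x)) =
      (S *ᵥ x) ⬝ᵥ (M⁻¹ *ᵥ (S *ᵥ x)) - 2 * γ * (x ⬝ᵥ (S *ᵥ x)) +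
        γ ^ 2 * (x ⬝ᵥ (M *ᵥ x)) := by
  have hinv : M⁻¹ *ᵥ (M *ᵥ x) = x := by
    rw [mulVec_mulVec, nonsing_inv_mul _ hdet, one_mulVec]
  have hcross : (M *ᵥ x) ⬝ᵥ (M⁻¹ *ᵥ (S *ᵥ x)) = x ⬝ᵥ (S *ᵥ x) := by
    rw [← vecMul_transpose, hM.eq, ← dotProduct_mulVec, mulVec_mulVec,
      mul_nonsing_inv _ hdet, one_mulVec]
  rw [sub_mulVec, smul_mulVec, mulVec_sub, mulVec_smul, hinv]
  simp only [sub_dotProduct, dotProduct_sub, smul_dotProduct, dotProduct_smul, smul_eq_mul,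
    hcross, dotProduct_comm (S *ᵥ x) x, dotProduct_comm (M *ᵥ x) x]
  ring

theorem dotProduct_transpose_mul_self_mulVec {m n : Type*} [Fintype m] [Fintype n]
    (A : Matrix m n ℝ) (x : n → ℝ) :
    x ⬝ᵥ ((Aᵀ * A) *ᵥ x) = (A *ᵥ x) ⬝ᵥ (A *ᵥ x) := by
  rw [← mulVec_mulVec, dotProduct_mulVec, vecMul_transpose]

theorem eucNorm_sq {n : ℕ} (x : Fin n → ℝ) : eucNorm x ^ 2 = x ⬝ᵥ x :=
  Real.sq_sqrt (Finset.sum_nonneg fun i _ => mul_self_nonneg (x i))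

theorem eucNorm_smul_sq {n : ℕ} (c : ℝ) (x : Fin n → ℝ) :
    eucNorm (c • x) ^ 2 = c ^ 2 * eucNorm x ^ 2 := by
  simp only [eucNorm_sq, smul_dotProduct, dotProduct_smul, smul_eq_mul]
  ring

/-- Optimality of the Rayleigh-quotient value `γ* = ‖A x‖² / ‖B x‖²` in the
`(Bᵀ B)⁻¹`-norm residual sense: for every `γ`,
`‖(Aᵀ A − γ* Bᵀ B) x‖_{M⁻¹} ≤ ‖(Aᵀ A − γ Bᵀ B) x‖_{M⁻¹}` with `M = Bᵀ B`; in
particular, for `A x = α u`, `B x = β v` with unit `u, v` and `α, β > 0`,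
`θ = α/β` is optimal among all `φ`. -/
theorem rayleigh_quotient_optimal_in_Minv_norm (m p n : ℕ)
    (A : Matrix (Fin m) (Fin n) ℝ) (B : Matrix (Fin p) (Fin n) ℝ)
    (hrank : B.rank = n) (hdet : IsUnit (Bᵀ * B).det)
    (x : Fin n → ℝ) (hBx : B *ᵥ x ≠ 0) :
    let M : Matrix (Fin n) (Fin n) ℝ := Bᵀ * B
    let nrmInv : (Fin n → ℝ) → ℝ := fun w => Real.sqrt (w ⬝ᵥ (M⁻¹ *ᵥ w))
    let γstar : ℝ := eucNorm (A *ᵥ x) ^ 2 / eucNorm (B *ᵥ x) ^ 2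
    (∀ γ : ℝ,
      nrmInv ((Aᵀ * A - γstar • M) *ᵥ x) ≤ nrmInv ((Aᵀ * A - γ • M) *ᵥ x)) ∧
    (∀ (α β : ℝ) (u : Fin m → ℝ) (v : Fin p → ℝ),
      0 < α → 0 < β → eucNorm u = 1 → eucNorm v = 1 →
      A *ᵥ x = α • u → B *ᵥ x = β • v →
      ∀ φ : ℝ,
        nrmInv ((Aᵀ * A - (α / β) ^ 2 • M) *ᵥ x)
          ≤ nrmInv ((Aᵀ * A - φ ^ 2 • M) *ᵥ x)) := by
  intro M nrmInv γstar
  have hopt : ∀ γ : ℝ,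
      nrmInv ((Aᵀ * A - γstar • M) *ᵥ x) ≤ nrmInv ((Aᵀ * A - γ • M) *ᵥ x) := by
    intro γ
    have hM : M.IsSymm := by
      simp [M, IsSymm, transpose_mul]
    have hb : 0 < (B *ᵥ x) ⬝ᵥ (B *ᵥ x) :=
      (Finset.sum_nonneg fun i _ => mul_self_nonneg ((B *ᵥ x) i)).lt_of_ne' (dotProduct_self_eq_zero.not.mpr hBx)
    have hγ : γstar * ((B *ᵥ x) ⬝ᵥ (B *ᵥ x)) = (A *ᵥ x) ⬝ᵥ (A *ᵥ x) := by
      simp only [γstar, eucNorm_sq]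
      exact div_mul_cancel₀ _ hb.ne'
    apply Real.sqrt_le_sqrt
    rw [dotProduct_inv_mulVec_sub_smul hM hdet, dotProduct_inv_mulVec_sub_smul hM hdet,
      dotProduct_transpose_mul_self_mulVec A, dotProduct_transpose_mul_self_mulVec B, ← hγ]
    nlinarith [mul_nonneg hb.le (sq_nonneg (γ - γstar))]
  refine ⟨hopt, fun α β u v _ _ hu hv hA hB φ => ?_⟩
  have hθ : (α / β) ^ 2 = γstar := by
    simp only [γstar, hA, hB, eucNorm_smul_sq, hu, hv, one_pow, mul_one, div_pow]
  rw [hθ]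
  exact hopt (φ ^ 2)
end
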